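/- Let P be an (n+3)×(n+3) symmetric positive semidefinite real matrix whose 2×2 submatrix [[P_{1,1}, P_{1,n+3}],[P_{n+3,1}, P_{n+3,n+3}]] is invertible, y ∈ ℝ^{n+1}, and let Π be the (n+1)×(n+3) matrix with Π(x_1,...,x_{n+3})ᵀ = (x_2,...,x_{n+2})ᵀ. Then the minimization of xᵀ P x over {x ∈ ℝ^{n+3} : Π x = y} has a unique minimizer x⁰, and (λP + ΠᵀΠ)^{-1} Πᵀ y → x⁰ as λ → 0+; in particular the middle coordinates of x⁰ equal y. -/

import Mathlib

open Matrix Filter Topology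

/-- The (n+1)×(n+3) matrix Π with Π(x₁,...,x_{n+3})ᵀ = (x₂,...,x_{n+2})ᵀ. -/
def PiMat (n : ℕ) : Matrix (Fin (n + 1)) (Fin (n + 3)) ℝ :=
  Matrix.of fun i j => if (j : ℕ) = (i : ℕ) + 1 then 1 else 0

/-- The matrix `PiMat n` drops the first and the last coordinate. -/
lemma PiMat_mulVec_apply (n : ℕ) (x : Fin (n + 3) → ℝ) (i : Fin (n + 1)) :
    (PiMat n *ᵥ x) i = x i.castSucc.succ := by
  have h : ∀ j : Fin (n + 3), (j : ℕ) = (i : ℕ) + 1 ↔ j = i.castSucc.succ := by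
    intro j
    simp [Fin.ext_iff]
  simp [PiMat, mulVec, dotProduct, h]

lemma PiMat_mul_transpose (n : ℕ) : PiMat n * (PiMat n)ᵀ = 1 := by
  ext i j
  have h := PiMat_mulVec_apply n (fun k => (PiMat n) j k) i
  rw [mul_apply]
  simp only [mulVec, dotProduct] at h
  simp only [transpose_apply, h]
  simp [PiMat, one_apply, Fin.ext_iff]

/-- A positive semidefinite matrix with invertible corner submatrix is definite on the kernel of
`PiMat n`. -/
lemma eq_zero_of_PiMat_mulVec_eq_zero {n : ℕ}
    {P : Matrix (Fin (n + 3)) (Fin (n + 3)) ℝ} (hP : P.PosSemidef)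
    (hQ : IsUnit !![P 0 0, P 0 (Fin.last (n + 2));
                    P (Fin.last (n + 2)) 0, P (Fin.last (n + 2)) (Fin.last (n + 2))])
    {w : Fin (n + 3) → ℝ} (hw : PiMat n *ᵥ w = 0) (hPw : w ⬝ᵥ (P *ᵥ w) = 0) : w = 0 := by
  have hPw' : P *ᵥ w = 0 := (hP.dotProduct_mulVec_zero_iff w).1 (by simpa using hPw)
  have hmid : ∀ i : Fin (n + 1), w i.castSucc.succ = 0 := fun i => by
    rw [← PiMat_mulVec_apply n w, hw, Pi.zero_apply]
  have hrow : ∀ k, P k 0 * w 0 + P k (Fin.last (n + 2)) * w (Fin.last (n + 2)) = 0 := by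
    intro k
    have h := congrFun hPw' k
    simp only [mulVec, dotProduct, Pi.zero_apply] at h
    rw [Fin.sum_univ_succ, Fin.sum_univ_castSucc] at h
    simpa [hmid] using h
  have hcorner : !![P 0 0, P 0 (Fin.last (n + 2));
      P (Fin.last (n + 2)) 0, P (Fin.last (n + 2)) (Fin.last (n + 2))] *ᵥ
        ![w 0, w (Fin.last (n + 2))] = 0 := by
    ext i
    fin_cases i
    · simpa [mulVec, dotProduct] using hrow 0
    · simpa [mulVec, dotProduct] using hrow (Fin.last (n + 2))
  have hends := mulVec_injective_of_isUnit hQ (hcorner.trans (mulVec_zero _).symm)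
  have h0 : w 0 = 0 := congrFun hends 0
  have hl : w (Fin.last (n + 2)) = 0 := congrFun hends 1
  ext j
  refine Fin.cases h0 (fun j => ?_) j
  exact Fin.lastCases hl hmid j

section ConstrainedMinimum

variable {m k : Type*} [Fintype m] [DecidableEq m] [Fintype k] [DecidableEq k]

/-- The matrix `λP + BᵀB` factors through a matrix that stays invertible at `λ = 0`. -/
lemma smul_add_inv_mulVec (P : Matrix m m ℝ) {B : Matrix k m ℝ} (hB : B * Bᵀ = 1) (y : k → ℝ)
    {l : ℝ} (hl : l ≠ 0) :
    (l • P + Bᵀ * B)⁻¹ *ᵥ (Bᵀ *ᵥ y) =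
      ((l • (Bᵀ * B) + (1 - Bᵀ * B)) * P + Bᵀ * B)⁻¹ *ᵥ (Bᵀ *ᵥ y) := by
  have hEB : Bᵀ * B * Bᵀ = Bᵀ := by rw [Matrix.mul_assoc, hB, Matrix.mul_one]
  set E := Bᵀ * B with hE
  have hEE : E * E = E := by
    nth_rewrite 2 [hE]
    rw [← Matrix.mul_assoc, hEB]
  have hfactor : l • P + E = (E + l • (1 - E)) * ((l • E + (1 - E)) * P + E) := by
    simp only [Matrix.add_mul, Matrix.mul_add, Matrix.sub_mul, Matrix.mul_sub, Matrix.smul_mul,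
      Matrix.mul_smul, ← Matrix.mul_assoc, hEE, Matrix.one_mul]
    module
  have hinv : (E + l • (1 - E))⁻¹ = E + l⁻¹ • (1 - E) := by
    refine inv_eq_left_inv ?_
    simp only [Matrix.add_mul, Matrix.mul_add, Matrix.sub_mul, Matrix.mul_sub, Matrix.smul_mul,
      Matrix.mul_smul, hEE, Matrix.one_mul, Matrix.mul_one]
    match_scalars <;> field_simp <;> ring
  have hfix : (E + l⁻¹ • (1 - E)) * Bᵀ = Bᵀ := by
    simp only [Matrix.add_mul, Matrix.sub_mul, Matrix.smul_mul, hEB, Matrix.one_mul, sub_self,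
      smul_zero, add_zero]
  rw [hfactor, Matrix.mul_inv_rev, hinv, ← mulVec_mulVec, mulVec_mulVec _ _ Bᵀ, hfix]

lemma isUnit_compl_mul_add {P : Matrix m m ℝ} {B : Matrix k m ℝ} (hB : B * Bᵀ = 1)
    (hker : ∀ w, B *ᵥ w = 0 → w ⬝ᵥ (P *ᵥ w) = 0 → w = 0) :
    IsUnit ((1 - Bᵀ * B) * P + Bᵀ * B) := by
  rw [← mulVec_injective_iff_isUnit]
  refine (injective_iff_map_eq_zero ((1 - Bᵀ * B) * P + Bᵀ * B).mulVecLin).2 fun w hw => ?_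
  rw [mulVecLin_apply] at hw
  have hBN : B * ((1 - Bᵀ * B) * P + Bᵀ * B) = B := by
    simp [Matrix.mul_add, Matrix.mul_sub, Matrix.sub_mul, ← Matrix.mul_assoc, hB]
  have hBw : B *ᵥ w = 0 := by
    rw [← hBN, ← mulVec_mulVec, hw, mulVec_zero]
  refine hker w hBw ?_
  have h : w ⬝ᵥ (((1 - Bᵀ * B) * P + Bᵀ * B) *ᵥ w) = w ⬝ᵥ (P *ᵥ w) := by
    simp only [Matrix.sub_mul, Matrix.one_mul, add_mulVec, sub_mulVec, ← mulVec_mulVec, hBw,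
      mulVec_zero, add_zero, dotProduct_sub]
    rw [dotProduct_mulVec w Bᵀ, vecMul_transpose, hBw, zero_dotProduct, sub_zero]
  rw [← h, hw, dotProduct_zero]

/-- If `BBᵀ = 1` and `P` is positive semidefinite and definite on the kernel of `B`, then the
quadratic form of `P` has a unique minimizer on `{x | Bx = y}`, and it is the limit of the
regularized solutions `(λP + BᵀB)⁻¹Bᵀy`. -/
theorem exists_unique_minimizer_tendsto {P : Matrix m m ℝ} (hP : P.PosSemidef)
    {B : Matrix k m ℝ} (hB : B * Bᵀ = 1)
    (hker : ∀ w, B *ᵥ w = 0 → w ⬝ᵥ (P *ᵥ w) = 0 → w = 0) (y : k → ℝ) :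
    ∃ x₀ : m → ℝ,
      (B *ᵥ x₀ = y ∧ ∀ z : m → ℝ, B *ᵥ z = y → x₀ ⬝ᵥ (P *ᵥ x₀) ≤ z ⬝ᵥ (P *ᵥ z)) ∧
      (∀ x' : m → ℝ,
        (B *ᵥ x' = y ∧ ∀ z : m → ℝ, B *ᵥ z = y → x' ⬝ᵥ (P *ᵥ x') ≤ z ⬝ᵥ (P *ᵥ z)) →
        x' = x₀) ∧
      Tendsto (fun l : ℝ => (l • P + Bᵀ * B)⁻¹ *ᵥ (Bᵀ *ᵥ y)) (𝓝[>] 0) (𝓝 x₀) := by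
  have hunit := isUnit_compl_mul_add hB hker
  set N := (1 - Bᵀ * B) * P + Bᵀ * B with hN
  set x₀ := N⁻¹ *ᵥ (Bᵀ *ᵥ y) with hx₀
  have hNx : N *ᵥ x₀ = Bᵀ *ᵥ y := by
    rw [hx₀, mulVec_mulVec, Matrix.mul_nonsing_inv _ ((isUnit_iff_isUnit_det _).1 hunit),
      one_mulVec]
  have hBN : B * N = B := by
    simp [hN, Matrix.mul_add, Matrix.mul_sub, Matrix.sub_mul, ← Matrix.mul_assoc, hB]
  have hBx : B *ᵥ x₀ = y := by
    rw [← hBN, ← mulVec_mulVec, hNx, mulVec_mulVec, hB, one_mulVec]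
  have horth : ∀ w, B *ᵥ w = 0 → w ⬝ᵥ (P *ᵥ x₀) = 0 := by
    intro w hw
    have hwB : ∀ v, w ⬝ᵥ (Bᵀ *ᵥ v) = 0 := fun v => by
      rw [dotProduct_mulVec, vecMul_transpose, hw, zero_dotProduct]
    have h := congrArg (w ⬝ᵥ ·) hNx
    simpa only [hN, Matrix.sub_mul, Matrix.one_mul, add_mulVec, sub_mulVec, ← mulVec_mulVec,
      dotProduct_add, dotProduct_sub, hwB, sub_zero, add_zero] using h
  have hpyth : ∀ z, B *ᵥ z = y →
      z ⬝ᵥ (P *ᵥ z) = x₀ ⬝ᵥ (P *ᵥ x₀) + (z - x₀) ⬝ᵥ (P *ᵥ (z - x₀)) := by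
    intro z hz
    have h := horth (z - x₀) (by rw [mulVec_sub, hz, hBx, sub_self])
    have hsymm : x₀ ⬝ᵥ (P *ᵥ z) = z ⬝ᵥ (P *ᵥ x₀) := by
      have hPt : Pᵀ = P := by simpa using hP.isHermitian.eq
      rw [dotProduct_mulVec, ← mulVec_transpose, hPt, dotProduct_comm]
    simp only [mulVec_sub, sub_dotProduct, dotProduct_sub] at h ⊢
    linarith
  refine ⟨x₀, ⟨hBx, fun z hz => ?_⟩, fun x' hx' => ?_, ?_⟩
  · rw [hpyth z hz]
    have := hP.dotProduct_mulVec_nonneg (z - x₀)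
    simpa using this
  · have hle := hx'.2 x₀ hBx
    have hnonneg : 0 ≤ (x' - x₀) ⬝ᵥ (P *ᵥ (x' - x₀)) := by
      simpa using hP.dotProduct_mulVec_nonneg (x' - x₀)
    rw [hpyth x' hx'.1] at hle
    exact sub_eq_zero.1 (hker _ (by rw [mulVec_sub, hx'.1, hBx, sub_self]) (by linarith))
  · have hdet : N.det ≠ 0 := ((isUnit_iff_isUnit_det _).1 hunit).ne_zero
    set F : ℝ → Matrix m m ℝ := fun l => (l • (Bᵀ * B) + (1 - Bᵀ * B)) * P + Bᵀ * B with hF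
    have hF0 : F 0 = N := by simp [hF, hN]
    have hFc : Continuous F := by fun_prop
    have hlim : Tendsto (fun l => (F l)⁻¹ *ᵥ (Bᵀ *ᵥ y)) (𝓝 0) (𝓝 x₀) := by
      have hcont : ContinuousAt
          (fun l => ((F l).det⁻¹ • (F l).adjugate) *ᵥ (Bᵀ *ᵥ y)) 0 := by
        have hdetc : ContinuousAt (fun l => (F l).det⁻¹) 0 :=
          hFc.matrix_det.continuousAt.inv₀ (by rwa [hF0])
        simp only [smul_mulVec]
        exact hdetc.smul (hFc.matrix_adjugate.matrix_mulVec continuous_const).continuousAt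
      simpa only [hx₀, ← hF0, inv_def, Ring.inverse_eq_inv'] using hcont.tendsto
    refine (hlim.mono_left nhdsWithin_le_nhds).congr' ?_
    filter_upwards [self_mem_nhdsWithin] with l hl
    exact (smul_add_inv_mulVec P hB y (ne_of_gt hl)).symm

end ConstrainedMinimum

/-- Let P be (n+3)×(n+3) symmetric positive semidefinite with invertible 2×2
corner submatrix, y ∈ ℝ^{n+1}.  Then minimizing xᵀPx over {x : Πx = y} has a unique
minimizer x⁰, and (λP + ΠᵀΠ)⁻¹Πᵀy → x⁰ as λ → 0+; in particular the middle coordinates of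
x⁰ equal y (i.e. Πx⁰ = y). -/
theorem stmt18 (n : ℕ) (hn : 1 ≤ n)
    (P : Matrix (Fin (n + 3)) (Fin (n + 3)) ℝ) (hP : P.PosSemidef)
    (hQ : IsUnit !![P 0 0, P 0 (Fin.last (n + 2));
                    P (Fin.last (n + 2)) 0, P (Fin.last (n + 2)) (Fin.last (n + 2))])
    (y : Fin (n + 1) → ℝ) :
    ∃ x₀ : Fin (n + 3) → ℝ,
      (PiMat n *ᵥ x₀ = y ∧
        ∀ z : Fin (n + 3) → ℝ, PiMat n *ᵥ z = y → x₀ ⬝ᵥ (P *ᵥ x₀) ≤ z ⬝ᵥ (P *ᵥ z)) ∧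
      (∀ x' : Fin (n + 3) → ℝ,
        (PiMat n *ᵥ x' = y ∧
          ∀ z : Fin (n + 3) → ℝ, PiMat n *ᵥ z = y → x' ⬝ᵥ (P *ᵥ x') ≤ z ⬝ᵥ (P *ᵥ z)) →
        x' = x₀) ∧
      Tendsto (fun lam : ℝ => (lam • P + (PiMat n)ᵀ * PiMat n)⁻¹ *ᵥ ((PiMat n)ᵀ *ᵥ y))
        (𝓝[>] 0) (𝓝 x₀) := by
  exact exists_unique_minimizer_tendsto hP (PiMat_mul_transpose n)
    (fun _ => eq_zero_of_PiMat_mulVec_eq_zero hP hQ) y
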